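/- Let F : Ω → ℝ^{n+k} be a translating soliton with respect to the unit vector W, S(x) = ⟨F(x), W⟩, and define the drift Laplacian L φ = Δ_g φ − Σ_{i,j} g^{ij} ∂_i S ∂_j φ. Then for every real a, the function u = e^{aS} satisfies L u = a(a − 1 − a|H̄|²) u on Ω. Consequently, if a > 1, ε > 0, and |H̄|² ≤ (a − 1 − ε)/a on Ω, then L u ≥ a ε u on Ω. -/

import Mathlib

open Real MeasureTheory

noncomputable section

/-- Partial derivative of a scalar function in the `i`-th coordinate direction. -/
def pd {n : ℕ} (i : Fin n) (φ : (Fin n → ℝ) → ℝ) (x : Fin n → ℝ) : ℝ :=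
  fderiv ℝ φ x (Pi.single i 1)

/-- Induced metric `g_{ij} = ⟨∂_i F, ∂_j F⟩`. -/
def gmat {n m : ℕ} (F : (Fin n → ℝ) → (Fin m → ℝ)) (x : Fin n → ℝ) :
    Matrix (Fin n) (Fin n) ℝ :=
  Matrix.of fun i j => ∑ a, pd i (fun y => F y a) x * pd j (fun y => F y a) x

/-- Inverse metric `g^{ij}`. -/
def ginv {n m : ℕ} (F : (Fin n → ℝ) → (Fin m → ℝ)) (x : Fin n → ℝ) :
    Matrix (Fin n) (Fin n) ℝ :=
  (gmat F x)⁻¹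

/-- Laplace–Beltrami operator `Δ_g φ = g^{-1/2} Σ_{i,j} ∂_i (g^{1/2} g^{ij} ∂_j φ)`. -/
def lapB {n m : ℕ} (F : (Fin n → ℝ) → (Fin m → ℝ)) (φ : (Fin n → ℝ) → ℝ)
    (x : Fin n → ℝ) : ℝ :=
  (Real.sqrt (gmat F x).det)⁻¹ *
    ∑ i, ∑ j, pd i (fun y => Real.sqrt (gmat F y).det * ginv F y i j * pd j φ y) x

/-- Mean curvature vector `H̄ = Δ_g F` (componentwise). -/
def Hvec {n m : ℕ} (F : (Fin n → ℝ) → (Fin m → ℝ)) (x : Fin n → ℝ) : Fin m → ℝ :=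
  fun a => lapB F (fun y => F y a) x

/-- Tangential projection of an ambient vector `V` onto `span{∂_1 F(x), …, ∂_n F(x)}`:
`V^⊤ = Σ_{i,j} g^{ij} ⟨V, ∂_j F⟩ ∂_i F`. -/
def tproj {n m : ℕ} (F : (Fin n → ℝ) → (Fin m → ℝ)) (x : Fin n → ℝ)
    (V : Fin m → ℝ) : Fin m → ℝ :=
  fun a => ∑ i, ∑ j, ginv F x i j * (∑ b, V b * pd j (fun y => F y b) x)
      * pd i (fun y => F y a) x

/-- `S(x) = ⟨F(x), W⟩`. -/
def Sfun {n m : ℕ} (F : (Fin n → ℝ) → (Fin m → ℝ)) (W : Fin m → ℝ)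
    (x : Fin n → ℝ) : ℝ :=
  ∑ a, F x a * W a

/-- Drift Laplacian `L φ = Δ_g φ − Σ_{i,j} g^{ij} ∂_i S ∂_j φ`. -/
def driftL {n m : ℕ} (F : (Fin n → ℝ) → (Fin m → ℝ)) (W : Fin m → ℝ)
    (φ : (Fin n → ℝ) → ℝ) (x : Fin n → ℝ) : ℝ :=
  lapB F φ x - ∑ i, ∑ j, ginv F x i j * pd i (Sfun F W) x * pd j φ x

open scoped ContDiff Matrix

section PartialDerivatives

variable {n : ℕ} {x : Fin n → ℝ}

theorem contDiffAt_pd {φ : (Fin n → ℝ) → ℝ} (hφ : ContDiffAt ℝ ∞ φ x) (i : Fin n) :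
    ContDiffAt ℝ ∞ (pd i φ) x :=
  (hφ.fderiv_right (m := ∞) (by simp)).clm_apply contDiffAt_const

theorem pd_congr {φ ψ : (Fin n → ℝ) → ℝ} (h : φ =ᶠ[nhds x] ψ) (i : Fin n) :
    pd i φ x = pd i ψ x := by
  rw [pd, pd, h.fderiv_eq]

theorem eventually_differentiableAt {m : ℕ} {φ : (Fin n → ℝ) → (Fin m → ℝ)}
    (hφ : ContDiffAt ℝ ∞ φ x) : ∀ᶠ y in nhds x, DifferentiableAt ℝ φ y :=
  ((hφ.of_le (m := 1) (by simp)).eventually (by simp)).mono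
    fun _ hy => hy.differentiableAt (by simp)

theorem pd_mul {φ ψ : (Fin n → ℝ) → ℝ} (hφ : DifferentiableAt ℝ φ x)
    (hψ : DifferentiableAt ℝ ψ x) (i : Fin n) :
    pd i (fun y => φ y * ψ y) x = pd i φ x * ψ x + φ x * pd i ψ x := by
  simp only [pd, fderiv_fun_mul hφ hψ]
  simp
  ring

theorem pd_const_mul {φ : (Fin n → ℝ) → ℝ} (hφ : DifferentiableAt ℝ φ x) (c : ℝ) (i : Fin n) :
    pd i (fun y => c * φ y) x = c * pd i φ x := by
  simp [pd, fderiv_const_mul hφ]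

theorem pd_sum_const_mul {ι : Type*} [Fintype ι] {φ : ι → (Fin n → ℝ) → ℝ}
    (hφ : ∀ b, DifferentiableAt ℝ (φ b) x) (c : ι → ℝ) (i : Fin n) :
    pd i (fun y => ∑ b, c b * φ b y) x = ∑ b, c b * pd i (φ b) x := by
  simp only [← pd_const_mul (hφ _)]
  simp only [pd]
  rw [fderiv_fun_sum fun b _ => (hφ b).const_mul (c b)]
  simp

theorem pd_exp_const_mul {φ : (Fin n → ℝ) → ℝ} (hφ : DifferentiableAt ℝ φ x) (a : ℝ)
    (i : Fin n) :
    pd i (fun y => Real.exp (a * φ y)) x = a * pd i φ x * Real.exp (a * φ x) := by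
  rw [← pd_const_mul hφ]
  simp only [pd, fderiv_exp (hφ.const_mul a)]
  simp
  ring

theorem pd_pd_exp_const_mul {φ : (Fin n → ℝ) → ℝ} (hφ : ContDiffAt ℝ ∞ φ x) (a : ℝ)
    (i j : Fin n) :
    pd i (pd j fun y => Real.exp (a * φ y)) x
      = (a * pd i (pd j φ) x + a ^ 2 * (pd i φ x * pd j φ x)) * Real.exp (a * φ x) := by
  have hev : (pd j fun y => Real.exp (a * φ y)) =ᶠ[nhds x]
      fun y => a * pd j φ y * Real.exp (a * φ y) :=
    ((hφ.of_le (m := 1) (by simp)).eventually (by simp)).mono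
      fun _ hy => pd_exp_const_mul (hy.differentiableAt (by simp)) a j
  have hd : DifferentiableAt ℝ φ x := hφ.differentiableAt (by simp)
  have hd' : DifferentiableAt ℝ (pd j φ) x := (contDiffAt_pd hφ j).differentiableAt (by simp)
  rw [pd_congr hev, pd_mul (hd'.const_mul a) (hd.const_mul a).exp, pd_const_mul hd',
    pd_exp_const_mul hd]
  ring

end PartialDerivatives

section Immersion

variable {n m : ℕ} {F : (Fin n → ℝ) → (Fin m → ℝ)} {x : Fin n → ℝ}

theorem pd_Sfun {W : Fin m → ℝ} (hF : ∀ b, DifferentiableAt ℝ (fun y => F y b) x) (i : Fin n) :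
    pd i (Sfun F W) x = ∑ b, W b * pd i (fun y => F y b) x := by
  rw [← pd_sum_const_mul hF W]
  simp only [mul_comm (W _)]
  rfl

theorem pd_pd_Sfun {W : Fin m → ℝ} (hF : ContDiffAt ℝ ∞ F x) (i j : Fin n) :
    pd i (pd j (Sfun F W)) x = ∑ b, W b * pd i (pd j fun y => F y b) x := by
  have hev : pd j (Sfun F W) =ᶠ[nhds x] fun y => ∑ b, W b * pd j (fun z => F z b) y :=
    (eventually_differentiableAt hF).mono fun _ hy => pd_Sfun (differentiableAt_pi.1 hy) j
  rw [pd_congr hev]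
  exact pd_sum_const_mul
    (fun b => (contDiffAt_pd (contDiffAt_pi.1 hF b) j).differentiableAt (by simp)) W i

theorem Matrix.contDiffAt_det {E ι : Type*} [NormedAddCommGroup E] [NormedSpace ℝ E] [Fintype ι]
    [DecidableEq ι] {A : E → Matrix ι ι ℝ} {p : E} {r : WithTop ℕ∞}
    (hA : ∀ i j, ContDiffAt ℝ r (fun y => A y i j) p) :
    ContDiffAt ℝ r (fun y => (A y).det) p := by
  simp only [Matrix.det_apply']
  exact ContDiffAt.sum fun σ _ => contDiffAt_const.mul (contDiffAt_prod fun i _ => hA _ _)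

theorem contDiffAt_gmat (hF : ContDiffAt ℝ ∞ F x) (i j : Fin n) :
    ContDiffAt ℝ ∞ (fun y => gmat F y i j) x := by
  simp only [gmat, Matrix.of_apply]
  exact ContDiffAt.sum fun b _ =>
    (contDiffAt_pd (contDiffAt_pi.1 hF b) i).mul (contDiffAt_pd (contDiffAt_pi.1 hF b) j)

theorem contDiffAt_ginv (hF : ContDiffAt ℝ ∞ F x) (hdet : (gmat F x).det ≠ 0) (i j : Fin n) :
    ContDiffAt ℝ ∞ (fun y => ginv F y i j) x := by
  simp only [ginv, Matrix.inv_def, Ring.inverse_eq_inv', Matrix.smul_apply, smul_eq_mul,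
    Matrix.adjugate_apply]
  refine ((Matrix.contDiffAt_det (contDiffAt_gmat hF)).inv hdet).mul
    (Matrix.contDiffAt_det fun k l => ?_)
  simp only [Matrix.updateRow_apply]
  split_ifs
  exacts [contDiffAt_const, contDiffAt_gmat hF k l]

theorem contDiffAt_sqrt_det_mul_ginv (hF : ContDiffAt ℝ ∞ F x) (hdet : (gmat F x).det ≠ 0)
    (i j : Fin n) :
    ContDiffAt ℝ ∞ (fun y => Real.sqrt (gmat F y).det * ginv F y i j) x :=
  ((Matrix.contDiffAt_det (contDiffAt_gmat hF)).sqrt hdet).mul (contDiffAt_ginv hF hdet i j)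

theorem lapB_eq (hF : ContDiffAt ℝ ∞ F x) (hdet : (gmat F x).det ≠ 0) {φ : (Fin n → ℝ) → ℝ}
    (hφ : ContDiffAt ℝ ∞ φ x) :
    lapB F φ x = (Real.sqrt (gmat F x).det)⁻¹ * ∑ i, ∑ j,
      (pd i (fun y => Real.sqrt (gmat F y).det * ginv F y i j) x * pd j φ x
        + Real.sqrt (gmat F x).det * ginv F x i j * pd i (pd j φ) x) := by
  rw [lapB]
  congr 1
  refine Finset.sum_congr rfl fun i _ => Finset.sum_congr rfl fun j _ => ?_
  exact pd_mul ((contDiffAt_sqrt_det_mul_ginv hF hdet i j).differentiableAt (by simp))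
    ((contDiffAt_pd hφ j).differentiableAt (by simp)) i

theorem lapB_Sfun {W : Fin m → ℝ} (hF : ContDiffAt ℝ ∞ F x) (hdet : 0 < (gmat F x).det) :
    lapB F (Sfun F W) x = ∑ b, W b * Hvec F x b := by
  have hcomp : ∀ b, ContDiffAt ℝ ∞ (fun y => F y b) x := contDiffAt_pi.1 hF
  have hS : ContDiffAt ℝ ∞ (Sfun F W) x :=
    ContDiffAt.sum fun b _ => (hcomp b).mul contDiffAt_const
  simp only [Hvec, lapB_eq hF hdet.ne' (hcomp _), lapB_eq hF hdet.ne' hS, pd_pd_Sfun hF,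
    pd_Sfun fun b => (hcomp b).differentiableAt (by simp)]
  simp only [Finset.mul_sum, ← Finset.sum_add_distrib]
  rw [Finset.sum_comm_cycle]
  refine Finset.sum_congr rfl fun b _ => Finset.sum_congr rfl fun i _ =>
    Finset.sum_congr rfl fun j _ => ?_
  ring

theorem lapB_exp_const_mul {φ : (Fin n → ℝ) → ℝ} (hF : ContDiffAt ℝ ∞ F x)
    (hφ : ContDiffAt ℝ ∞ φ x) (hdet : 0 < (gmat F x).det) {a : ℝ} :
    lapB F (fun y => Real.exp (a * φ y)) x = (a * lapB F φ x
      + a ^ 2 * ∑ i, ∑ j, ginv F x i j * pd i φ x * pd j φ x) * Real.exp (a * φ x) := by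
  have hs : Real.sqrt (gmat F x).det ≠ 0 := (Real.sqrt_pos.2 hdet).ne'
  rw [lapB_eq hF hdet.ne' hφ, lapB_eq hF hdet.ne' (contDiffAt_const.mul hφ).exp]
  simp only [pd_pd_exp_const_mul hφ, pd_exp_const_mul (hφ.differentiableAt (by simp))]
  simp only [Finset.mul_sum, Finset.sum_mul, ← Finset.sum_add_distrib]
  refine Finset.sum_congr rfl fun i _ => Finset.sum_congr rfl fun j _ => ?_
  field_simp
  ring

/-- The Jacobian of `F`, with rows `∂_i F`. -/
def jac (F : (Fin n → ℝ) → (Fin m → ℝ)) (x : Fin n → ℝ) : Matrix (Fin n) (Fin m) ℝ :=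
  Matrix.of fun i b => pd i (fun y => F y b) x

theorem gmat_eq_jac_mul_transpose : gmat F x = jac F x * (jac F x)ᵀ := by
  ext i j
  simp [gmat, jac, Matrix.mul_apply]

theorem tproj_eq_vecMul (W : Fin m → ℝ) :
    tproj F x W = (ginv F x *ᵥ (jac F x *ᵥ W)) ᵥ* jac F x := by
  ext b
  simp only [tproj, Matrix.vecMul, Matrix.mulVec, dotProduct, jac, Matrix.of_apply,
    Finset.sum_mul, mul_comm (W _)]

variable {p : Fin n → ℝ} (W : Fin m → ℝ)

theorem gradSq_eq_tproj_dot (hp : ∀ i, p i = ∑ b, W b * pd i (fun y => F y b) x) :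
    ∑ i, ∑ j, ginv F x i j * p i * p j = ∑ b, W b * tproj F x W b := by
  have hpJ : p = jac F x *ᵥ W := by
    ext i
    simp [hp, jac, Matrix.mulVec, dotProduct, mul_comm]
  have : ∑ b, W b * tproj F x W b = (ginv F x *ᵥ p) ⬝ᵥ p := by
    change W ⬝ᵥ tproj F x W = _
    rw [tproj_eq_vecMul, dotProduct_comm, ← Matrix.dotProduct_mulVec, ← hpJ]
  rw [this]
  simp only [Matrix.mulVec, dotProduct, Finset.sum_mul]
  exact Finset.sum_congr rfl fun i _ => Finset.sum_congr rfl fun j _ => by ring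

theorem tproj_normSq (hp : ∀ i, p i = ∑ b, W b * pd i (fun y => F y b) x)
    (hdet : (gmat F x).det ≠ 0) :
    ∑ b, (tproj F x W b) ^ 2 = ∑ i, ∑ j, ginv F x i j * p i * p j := by
  rw [gradSq_eq_tproj_dot W hp]
  have h : jac F x *ᵥ tproj F x W = jac F x *ᵥ W := by
    rw [tproj_eq_vecMul, ← Matrix.mulVec_transpose, Matrix.mulVec_mulVec,
      ← gmat_eq_jac_mul_transpose, Matrix.mulVec_mulVec, ginv,
      Matrix.mul_nonsing_inv _ hdet.isUnit, Matrix.one_mulVec]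
  calc ∑ b, (tproj F x W b) ^ 2 = tproj F x W ⬝ᵥ tproj F x W := by simp [dotProduct, sq]
    _ = (ginv F x *ᵥ (jac F x *ᵥ W)) ⬝ᵥ (jac F x *ᵥ tproj F x W) := by
      rw [Matrix.dotProduct_mulVec, ← tproj_eq_vecMul]
    _ = W ⬝ᵥ tproj F x W := by
      rw [h, Matrix.dotProduct_mulVec, ← tproj_eq_vecMul, dotProduct_comm]

end Immersion

/-- For every real `a`, the function `u = e^{aS}` satisfies
`L u = a(a − 1 − a|H̄|²) u` on `Ω`; consequently if `a > 1`, `ε > 0` and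
`|H̄|² ≤ (a − 1 − ε)/a` on `Ω` then `L u ≥ a ε u` on `Ω`. -/
theorem soliton_driftL_exp {n k : ℕ} (hn : 1 ≤ n) (hk : 1 ≤ k)
    (Ω : Set (Fin n → ℝ)) (hΩo : IsOpen Ω) (hΩne : Ω.Nonempty)
    (F : (Fin n → ℝ) → (Fin (n + k) → ℝ)) (hF : ContDiffOn ℝ (⊤ : ℕ∞) F Ω)
    (himm : ∀ x ∈ Ω, (gmat F x).PosDef)
    (W : Fin (n + k) → ℝ) (hW : ∑ a, (W a) ^ 2 = 1)
    (hsol : ∀ x ∈ Ω, ∀ a, Hvec F x a = -(W a - tproj F x W a)) :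
    (∀ a : ℝ, ∀ x ∈ Ω,
        driftL F W (fun y => Real.exp (a * Sfun F W y)) x
          = a * (a - 1 - a * ∑ b, (Hvec F x b) ^ 2) * Real.exp (a * Sfun F W x)) ∧
    (∀ a ε : ℝ, 1 < a → 0 < ε →
        (∀ x ∈ Ω, ∑ b, (Hvec F x b) ^ 2 ≤ (a - 1 - ε) / a) →
        ∀ x ∈ Ω,
          a * ε * Real.exp (a * Sfun F W x)
            ≤ driftL F W (fun y => Real.exp (a * Sfun F W y)) x) := by
  have key : ∀ a : ℝ, ∀ x ∈ Ω,
      driftL F W (fun y => Real.exp (a * Sfun F W y)) x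
        = a * (a - 1 - a * ∑ b, (Hvec F x b) ^ 2) * Real.exp (a * Sfun F W x) := by
    intro a x hx
    have hFx : ContDiffAt ℝ ∞ F x := hF.contDiffAt (hΩo.mem_nhds hx)
    have hcomp : ∀ b, ContDiffAt ℝ ∞ (fun y => F y b) x := contDiffAt_pi.1 hFx
    have hS : ContDiffAt ℝ ∞ (Sfun F W) x :=
      ContDiffAt.sum fun b _ => (hcomp b).mul contDiffAt_const
    have hdet : 0 < (gmat F x).det := (himm x hx).det_pos
    have hgrad : ∀ i, pd i (Sfun F W) x = ∑ b, W b * pd i (fun y => F y b) x :=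
      fun i => pd_Sfun (fun b => (hcomp b).differentiableAt (by simp)) i
    have hT := gradSq_eq_tproj_dot W hgrad
    have hN := tproj_normSq W hgrad hdet.ne'
    set T := ∑ i, ∑ j, ginv F x i j * pd i (Sfun F W) x * pd j (Sfun F W) x with hTdef
    have hHsq : ∑ b, (Hvec F x b) ^ 2 = 1 - T := by
      have : ∑ b, (Hvec F x b) ^ 2
          = ∑ b, (W b) ^ 2 - 2 * ∑ b, W b * tproj F x W b + ∑ b, (tproj F x W b) ^ 2 := by
        rw [Finset.mul_sum, ← Finset.sum_sub_distrib, ← Finset.sum_add_distrib]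
        exact Finset.sum_congr rfl fun b _ => by rw [hsol x hx b]; ring
      rw [this, hW, hN, ← hT]
      ring
    have hlapS : lapB F (Sfun F W) x = -(1 - T) := by
      rw [lapB_Sfun hFx hdet, ← hW, hT, ← Finset.sum_sub_distrib, ← Finset.sum_neg_distrib]
      exact Finset.sum_congr rfl fun b _ => by rw [hsol x hx b]; ring
    have hdrift : ∑ i, ∑ j, ginv F x i j * pd i (Sfun F W) x *
        pd j (fun y => Real.exp (a * Sfun F W y)) x
          = a * Real.exp (a * Sfun F W x) * T := by
      simp only [hTdef, Finset.mul_sum]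
      refine Finset.sum_congr rfl fun i _ => Finset.sum_congr rfl fun j _ => ?_
      rw [pd_exp_const_mul (hS.differentiableAt (by simp))]
      ring
    rw [driftL, hdrift, lapB_exp_const_mul hFx hS hdet, hlapS, hHsq]
    ring
  refine ⟨key, fun a ε ha _ hH x hx => ?_⟩
  rw [key a x hx]
  have ha0 : 0 < a := by linarith
  have h := (le_div_iff₀ ha0).1 (hH x hx)
  exact mul_le_mul_of_nonneg_right
    (mul_le_mul_of_nonneg_left (by linarith) ha0.le) (Real.exp_pos _).le
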